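/- arXiv:math/0408292 — 2 statements merged into one kernel-verified Lean document; each statement's English description precedes it below -/
import Mathlib

section
/- Every 7-term graphical sequence S with σ(S) ≥ 26 has a realization containing K_{3,1,1} as a subgraph. -/
open SimpleGraph Finset

/-- The multiset of vertex degrees of a finite simple graph. -/
def degMS {m : ℕ} (G : SimpleGraph (Fin m)) [DecidableRel G.Adj] : Multiset ℕ :=
  (Finset.univ : Finset (Fin m)).val.map fun v => G.degree v

/-- `G` contains `K_{p,1,1}` (complete tripartite with parts `p,1,1`) as a subgraph:
there are adjacent vertices `u, v` and `p` further vertices each adjacent to both. -/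
def ContainsKp11 {V : Type*} (G : SimpleGraph V) (p : ℕ) : Prop :=
  ∃ u v : V, G.Adj u v ∧ ∃ s : Finset V, s.card = p ∧ u ∉ s ∧ v ∉ s ∧
    ∀ w ∈ s, G.Adj u w ∧ G.Adj v w

namespace SimpleGraph

/-- One half of the Erdős–Gallai theorem: the bound satisfied by the degrees over any vertex set. -/
theorem sum_degree_le {V : Type*} [Fintype V] [DecidableEq V] (G : SimpleGraph V)
    [DecidableRel G.Adj] (T : Finset V) :
    ∑ v ∈ T, G.degree v ≤ #T * (#T - 1) + ∑ w ∈ Tᶜ, min (G.degree w) #T := by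
  have split (v : V) : G.degree v = #{w ∈ T | G.Adj v w} + #{w ∈ Tᶜ | G.Adj v w} := by
    rw [← card_neighborFinset_eq_degree, neighborFinset_eq_filter,
      ← card_union_of_disjoint (disjoint_filter_filter disjoint_compl_right), ← filter_union,
      union_compl]
  have inner : ∑ v ∈ T, #{w ∈ T | G.Adj v w} ≤ #T * (#T - 1) := by
    rw [← smul_eq_mul]
    refine sum_le_card_nsmul _ _ _ fun v hv => ?_
    rw [← card_erase_of_mem hv]
    refine card_le_card fun w hw => ?_
    rw [mem_filter] at hw
    exact mem_erase.2 ⟨hw.2.ne', hw.1⟩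
  have outer : ∑ v ∈ T, #{w ∈ Tᶜ | G.Adj v w} ≤ ∑ w ∈ Tᶜ, min (G.degree w) #T := by
    rw [show ∑ v ∈ T, #{w ∈ Tᶜ | G.Adj v w} = ∑ w ∈ Tᶜ, #{v ∈ T | G.Adj v w} from
      sum_card_bipartiteAbove_eq_sum_card_bipartiteBelow _]
    refine sum_le_sum fun w _ => le_min ?_ (card_filter_le _ _)
    simp only [G.adj_comm _ w]
    exact split w ▸ Nat.le_add_right _ _
  calc
    ∑ v ∈ T, G.degree v = _ := by rw [sum_congr rfl fun v _ => split v, sum_add_distrib]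
    _ ≤ _ := add_le_add inner outer

/-- Any graph on `Fin m` can be relabelled so that its degrees are listed in decreasing order. -/
theorem exists_antitone_degree {m : ℕ} (G : SimpleGraph (Fin m)) [DecidableRel G.Adj] :
    ∃ (H : SimpleGraph (Fin m)) (_ : DecidableRel H.Adj),
      degMS H = degMS G ∧ Antitone fun v => H.degree v := by
  let σ : Equiv.Perm (Fin m) := Tuple.sort fun v => OrderDual.toDual (G.degree v)
  have hdeg (v : Fin m) : (G.comap σ).degree v = G.degree (σ v) :=
    ((Iso.comap σ G).degree_eq v).symm
  refine ⟨G.comap σ, inferInstance, ?_, fun i j hij => ?_⟩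
  · simp only [degMS, hdeg]
    exact (Multiset.map_map (fun v => G.degree v) σ _).symm.trans
      (congrArg _ (Multiset.map_univ_val_equiv σ))
  · simp only [hdeg]
    exact Tuple.monotone_sort (fun v => OrderDual.toDual (G.degree v)) hij

/-- Whether the binary expansion `c`, read as the strictly lower triangular part of an adjacency
matrix, joins `i` and `j`. -/
def codeAdj (c i j : ℕ) : Bool :=
  if i < j then c.testBit (j * (j - 1) / 2 + i)
  else if j < i then c.testBit (i * (i - 1) / 2 + j)
  else false

/-- The graph on `Fin m` encoded by `c`. -/
def ofCode (m c : ℕ) : SimpleGraph (Fin m) where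
  Adj i j := codeAdj c i j
  symm := ⟨fun i j h => by unfold codeAdj at *; grind⟩
  loopless := ⟨fun i h => by simp [codeAdj] at h⟩

instance (m c : ℕ) : DecidableRel (ofCode m c).Adj := fun i j =>
  inferInstanceAs (Decidable (codeAdj c i j = true))

/-- The degree of vertex `i` in the graph on seven vertices encoded by `c`. -/
def codeDegree (c i : ℕ) : ℕ :=
  (codeAdj c i 0).toNat + (codeAdj c i 1).toNat + (codeAdj c i 2).toNat + (codeAdj c i 3).toNat +
    (codeAdj c i 4).toNat + (codeAdj c i 5).toNat + (codeAdj c i 6).toNat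

theorem degree_ofCode (c : ℕ) (i : Fin 7) : (ofCode 7 c).degree i = codeDegree c i := by
  rw [← card_neighborFinset_eq_degree, neighborFinset_eq_filter, card_filter, Fin.sum_univ_seven]
  simp [ofCode, codeDegree, Bool.toNat, Bool.cond_eq_ite]
  rfl

/-- Codes of graphs on seven vertices, one for each decreasing graphical sequence of sum at
least 26, in which vertices `0` and `1` are adjacent to each other and to `2`, `3` and `4`. -/
def kThreeCodes : List ℕ :=
  [8191, 16351, 16383, 32767, 36863, 39935, 40447, 40703, 40959, 47071, 48095, 48127, 49119,
   49151, 64511, 65535, 101887, 102399, 103935, 104191, 104447, 105983, 106207, 106239, 106495,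
   111583, 111615, 112607, 112639, 114655, 114687, 127999, 129023, 131071, 139007, 147423,
   161503, 170751, 171743, 171775, 174047, 177887, 178655, 178911, 178943, 179167, 180191,
   193247, 194271, 195295, 237055, 237279, 237311, 237567, 241631, 241663, 243167, 243423,
   243455, 243679, 245727, 245759, 255199, 255999, 258047, 258271, 258783, 259807, 262143,
   409567, 425951, 440799, 441311, 442335, 447711, 448223, 454879, 457183, 457695, 458719,
   507871, 507903, 515583, 515807, 516095, 521695, 522207, 524255, 524287, 946399, 947423,
   980191, 981215, 981247, 1048063, 1048575, 1209055, 1506271, 1570783, 1994975, 2097151]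

theorem containsKp11_of_mem_kThreeCodes {c : ℕ} (hc : c ∈ kThreeCodes) :
    ContainsKp11 (ofCode 7 c) 3 := by
  have h : ∀ c ∈ kThreeCodes, codeAdj c 0 1 ∧ (codeAdj c 0 2 ∧ codeAdj c 1 2) ∧
      (codeAdj c 0 3 ∧ codeAdj c 1 3) ∧ codeAdj c 0 4 ∧ codeAdj c 1 4 := by
    decide +kernel
  obtain ⟨h₁, h₂, h₃, h₄⟩ := h c hc
  refine ⟨0, 1, h₁, {2, 3, 4}, by decide, by decide, by decide, fun w hw => ?_⟩
  simp only [mem_insert, mem_singleton] at hw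
  rcases hw with rfl | rfl | rfl
  exacts [h₂, h₃, h₄]

/-- The Erdős–Gallai conditions on a decreasing sequence of length seven, the last two omitted. -/
def erdosGallaiSeven (a b c d e f g : ℕ) : Prop :=
  a ≤ min b 1 + min c 1 + min d 1 + min e 1 + min f 1 + min g 1 ∧
  a + b ≤ 2 + min c 2 + min d 2 + min e 2 + min f 2 + min g 2 ∧
  a + b + c ≤ 6 + min d 3 + min e 3 + min f 3 + min g 3 ∧
  a + b + c + d ≤ 12 + min e 4 + min f 4 + min g 4 ∧
  a + b + c + d + e ≤ 20 + min f 5 + min g 5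

instance (a b c d e f g : ℕ) : Decidable (erdosGallaiSeven a b c d e f g) := by
  unfold erdosGallaiSeven; infer_instance

theorem erdosGallaiSeven_degree (G : SimpleGraph (Fin 7)) [DecidableRel G.Adj] :
    erdosGallaiSeven (G.degree 0) (G.degree 1) (G.degree 2) (G.degree 3) (G.degree 4)
      (G.degree 5) (G.degree 6) := by
  have key (T U : Finset (Fin 7)) (h : Tᶜ = U) := h ▸ G.sum_degree_le T
  have h₁ := key {0} {1, 2, 3, 4, 5, 6} (by decide)
  have h₂ := key {0, 1} {2, 3, 4, 5, 6} (by decide)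
  have h₃ := key {0, 1, 2} {3, 4, 5, 6} (by decide)
  have h₄ := key {0, 1, 2, 3} {4, 5, 6} (by decide)
  have h₅ := key {0, 1, 2, 3, 4} {5, 6} (by decide)
  simp at h₁ h₂ h₃ h₄ h₅
  unfold erdosGallaiSeven
  omega

set_option synthInstance.maxSize 4000000 in
theorem exists_mem_kThreeCodes : ∀ a < 7, ∀ b ≤ a, ∀ c ≤ b, ∀ d ≤ c, ∀ e ≤ d, ∀ f ≤ e, ∀ g ≤ f,
    26 ≤ a + b + c + d + e + f + g → Even (a + b + c + d + e + f + g) →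
    erdosGallaiSeven a b c d e f g →
    ∃ k ∈ kThreeCodes, codeDegree k 0 = a ∧ codeDegree k 1 = b ∧ codeDegree k 2 = c ∧
      codeDegree k 3 = d ∧ codeDegree k 4 = e ∧ codeDegree k 5 = f ∧ codeDegree k 6 = g := by
  decide +kernel

end SimpleGraph

theorem stmt_13 (S : Multiset ℕ) (hcard : S.card = 7)
    (hgraphical : ∃ (G : SimpleGraph (Fin 7)) (_ : DecidableRel G.Adj), degMS G = S)
    (hsum : 26 ≤ S.sum) :
    ∃ (G : SimpleGraph (Fin 7)) (_ : DecidableRel G.Adj),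
      degMS G = S ∧ ContainsKp11 G 3 := by
  obtain ⟨G, _, rfl⟩ := hgraphical
  obtain ⟨H, _, hdeg, hanti⟩ := G.exists_antitone_degree
  rw [← hdeg] at hsum ⊢
  have hsum' : (degMS H).sum = ∑ v, H.degree v := rfl
  have heven : Even (∑ v, H.degree v) := H.sum_degrees_eq_twice_card_edges ▸ even_two_mul _
  rw [hsum', Fin.sum_univ_seven] at hsum
  rw [Fin.sum_univ_seven] at heven
  have anti {i j : Fin 7} (h : i ≤ j) : H.degree j ≤ H.degree i := hanti h
  obtain ⟨k, hk, h⟩ := exists_mem_kThreeCodes _ (H.degree_lt_card_verts 0) _ (anti (by decide))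
    _ (anti (by decide)) _ (anti (by decide)) _ (anti (by decide)) _ (anti (by decide))
    _ (anti (by decide)) hsum heven H.erdosGallaiSeven_degree
  refine ⟨ofCode 7 k, inferInstance, ?_, containsKp11_of_mem_kThreeCodes hk⟩
  refine Multiset.map_congr rfl fun v _ => ?_
  rw [degree_ofCode]
  obtain ⟨h₀, h₁, h₂, h₃, h₄, h₅, h₆⟩ := h
  fin_cases v <;> assumption
end

section
/- σ(K_{3,1,1}, 6) = 26: every 6-term graphical sequence with sum at least 26 is potentially K_{3,1,1}-graphic, while (4^6) has sum 24 and is graphical but not potentially K_{3,1,1}-graphic. -/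
open SimpleGraph Finset

section

variable {V : Type*} [Fintype V] [DecidableEq V] (G : SimpleGraph V) [DecidableRel G.Adj]

/-- Two distinct vertices of full degree, together with `p` of the remaining vertices,
span `K_{p,1,1}`. -/
theorem containsKp11_of_degree_eq {p : ℕ} (hp : p + 2 ≤ Fintype.card V) {u v : V} (huv : u ≠ v)
    (hu : G.degree u + 1 = Fintype.card V) (hv : G.degree v + 1 = Fintype.card V) :
    ContainsKp11 G p := by
  have full {a : V} (ha : G.degree a + 1 = Fintype.card V) (b : V) (hab : a ≠ b) : G.Adj a b := by
    have h : insert a (G.neighborFinset a) = univ := by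
      rw [← Finset.card_eq_iff_eq_univ, card_insert_of_notMem (by simp),
        card_neighborFinset_eq_degree, ha]
    have hb : b ∈ insert a (G.neighborFinset a) := h ▸ mem_univ b
    simpa [hab.symm] using hb
  have hcard : p ≤ (univ \ {u, v} : Finset V).card := by
    rw [card_sdiff_of_subset (subset_univ _), card_pair huv, card_univ]
    omega
  obtain ⟨s, hs, hsp⟩ := exists_subset_card_eq hcard
  have hs' {w : V} (hw : w ∈ s) : w ≠ u ∧ w ≠ v := by simpa using hs hw
  exact ⟨u, v, full hu v huv, s, hsp, fun h => (hs' h).1 rfl, fun h => (hs' h).2 rfl,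
    fun w hw => ⟨full hu w (hs' hw).1.symm, full hv w (hs' hw).2.symm⟩⟩

/-- A `(p+1)`-regular graph on `p + 3` vertices does not contain `K_{p,1,1}`. -/
theorem not_containsKp11_of_isRegularOfDegree {p : ℕ} (hV : Fintype.card V = p + 3)
    (hG : G.IsRegularOfDegree (p + 1)) : ¬ ContainsKp11 G p := by
  rintro ⟨u, v, huv, s, hsp, hus, hvs, hs⟩
  have hNu : insert v s = G.neighborFinset u := by
    refine eq_of_subset_of_card_le (fun w hw => ?_) ?_
    · rcases mem_insert.1 hw with rfl | hw
      · simpa using huv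
      · simpa using (hs w hw).1
    · rw [card_neighborFinset_eq_degree, hG u, card_insert_of_notMem hvs, hsp]
  have hNv : insert u s = G.neighborFinset v := by
    refine eq_of_subset_of_card_le (fun w hw => ?_) ?_
    · rcases mem_insert.1 hw with rfl | hw
      · simpa using huv.symm
      · simpa using (hs w hw).2
    · rw [card_neighborFinset_eq_degree, hG v, card_insert_of_notMem hus, hsp]
  have hT : (insert u (insert v s)).card < (univ : Finset V).card := by
    rw [card_insert_of_notMem (by simp [hus, huv.ne]), card_insert_of_notMem hvs, hsp,
      card_univ, hV]
    omega
  obtain ⟨x, -, hx⟩ := exists_mem_notMem_of_card_lt_card hT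
  simp only [mem_insert, not_or] at hx
  have hxu : ¬ G.Adj u x := by
    rw [← mem_neighborFinset, ← hNu]; simp [hx]
  have hxv : ¬ G.Adj v x := by
    rw [← mem_neighborFinset, ← hNv]; simp [hx]
  have hsub : G.neighborFinset x ⊆ univ \ {u, v, x} := by
    intro w hw
    rw [mem_neighborFinset] at hw
    simp only [mem_sdiff, mem_univ, true_and, mem_insert, mem_singleton, not_or]
    exact ⟨fun h => hxu (h ▸ hw.symm), fun h => hxv (h ▸ hw.symm), hw.ne'⟩
  have hle := card_le_card hsub
  rw [card_neighborFinset_eq_degree, hG x, card_sdiff_of_subset (subset_univ _),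
    card_univ, hV, card_eq_three.2 ⟨u, v, x, huv.ne, Ne.symm hx.1, Ne.symm hx.2.1, rfl⟩] at hle
  omega

end

theorem stmt_15 :
    (∀ S : Multiset ℕ, S.card = 6 →
      (∃ (G : SimpleGraph (Fin 6)) (_ : DecidableRel G.Adj), degMS G = S) →
      26 ≤ S.sum →
      ∃ (G : SimpleGraph (Fin 6)) (_ : DecidableRel G.Adj),
        degMS G = S ∧ ContainsKp11 G 3) ∧
    (Multiset.replicate 6 4).sum = 24 ∧
    (∃ (G : SimpleGraph (Fin 6)) (_ : DecidableRel G.Adj),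
      degMS G = Multiset.replicate 6 4) ∧
    ¬ ∃ (G : SimpleGraph (Fin 6)) (_ : DecidableRel G.Adj),
        degMS G = Multiset.replicate 6 4 ∧ ContainsKp11 G 3 := by
  refine ⟨?_, by simp, ?_, ?_⟩
  · rintro S - ⟨G, hdec, rfl⟩ hsum
    refine ⟨G, hdec, rfl, ?_⟩
    have hsum' : 26 ≤ ∑ v, G.degree v := hsum
    have hle (v : Fin 6) : G.degree v ≤ 5 := Nat.le_of_lt_succ (G.degree_lt_card_verts v)
    have hbound : ∑ v, G.degree v ≤ ∑ v, (4 + if G.degree v = 5 then 1 else 0) :=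
      sum_le_sum fun v _ => by have := hle v; split_ifs <;> omega
    rw [sum_add_distrib, sum_boole] at hbound
    have hcard : 1 < (univ.filter fun v => G.degree v = 5).card := by
      simp only [sum_const, card_univ, Fintype.card_fin, smul_eq_mul, Nat.cast_id] at hbound
      omega
    obtain ⟨u, hu, v, hv, huv⟩ := one_lt_card.1 hcard
    simp only [mem_filter, mem_univ, true_and] at hu hv
    exact containsKp11_of_degree_eq G (by simp) huv (by simp [hu]) (by simp [hv])
  · let G : SimpleGraph (Fin 6) :=
      { Adj := fun i j => i.val % 3 ≠ j.val % 3
        symm := ⟨fun _ _ h => h.symm⟩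
        loopless := ⟨fun _ h => h rfl⟩ }
    let hdec : DecidableRel G.Adj := fun i j => inferInstanceAs (Decidable (i.val % 3 ≠ j.val % 3))
    exact ⟨G, hdec, by decide⟩
  · rintro ⟨G, hdec, hdeg, hK⟩
    refine not_containsKp11_of_isRegularOfDegree G (by simp) (fun v => ?_) hK
    have hv : G.degree v ∈ degMS G := Multiset.mem_map_of_mem _ (mem_univ v)
    rw [hdeg] at hv
    exact Multiset.eq_of_mem_replicate hv
end
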